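/- arXiv:0709.0531 — 10 statements merged into one kernel-verified Lean document; each statement's English description precedes it below -/
import Mathlib

section
/- Let a, b, c, d₁, d₂ be real numbers with c ≥ a ≥ d₁ > 0 and c ≥ b > d₂ > 0. Then there exists at most one β > 0 satisfying d₁^(−β) + d₂^(−β) − a^(−β) − b^(−β) − c^(−β) + 1 = 0. -/
theorem bern_aux (z l : ℝ) (hz : 0 < z) (h0 : 0 < l) (h1 : l < 1) : z ^ l - 1 ≤ l * (z - 1) := by
  have := rpow_one_add_le_one_add_mul_self (s := z - 1) (by linarith) h0.le h1.le
  rw [show 1 + (z - 1) = z by ring] at this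
  linarith

theorem diff_aux (x y l : ℝ) (hy : 1 ≤ y) (hxy : y ≤ x) (h0 : 0 < l) (h1 : l < 1) :
    x ^ l - y ^ l ≤ l * (x - y) ∧ (y < x → x ^ l - y ^ l < l * (x - y)) := by
  have hy0 : 0 < y := by linarith
  have hx0 : 0 < x := by linarith
  have e : x ^ l = y ^ l * (x / y) ^ l := by
    rw [← Real.mul_rpow hy0.le (by positivity), mul_div_cancel₀ _ hy0.ne']
  have hyl : y ^ l ≤ y := by
    simpa using Real.rpow_le_rpow_of_exponent_le hy h1.le
  have hp : 0 < y ^ l := Real.rpow_pos_of_pos hy0 l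
  have hr : 1 ≤ x / y := by rwa [one_le_div hy0]
  have hm : y ^ l * (l * (x / y - 1)) ≤ l * (x - y) := by
    have : y ^ l * (l * (x / y - 1)) ≤ y * (l * (x / y - 1)) :=
      mul_le_mul_of_nonneg_right hyl (mul_nonneg h0.le (by linarith))
    have e2 : y * (l * (x / y - 1)) = l * (x - y) := by field_simp
    linarith
  constructor
  · have := mul_le_mul_of_nonneg_left (bern_aux (x / y) l (by linarith) h0 h1) hp.le
    rw [e]; linarith
  · intro h
    have hr' : 1 < x / y := by rwa [one_lt_div hy0]
    have := rpow_one_add_lt_one_add_mul_self (s := x / y - 1) (by linarith)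
      (by linarith) h0 h1
    rw [show 1 + (x / y - 1) = x / y by ring] at this
    have := mul_lt_mul_of_pos_left this hp
    rw [e]; linarith

theorem no_two (a b c d₁ d₂ : ℝ)
    (h1 : c ≥ a) (h2 : a ≥ d₁) (h3 : d₁ > 0)
    (h4 : c ≥ b) (h5 : b > d₂) (h6 : d₂ > 0) (s t : ℝ) (hs : 0 < s) (hst : s < t)
    (es : d₁ ^ (-s) + d₂ ^ (-s) - a ^ (-s) - b ^ (-s) - c ^ (-s) + 1 = 0)
    (et : d₁ ^ (-t) + d₂ ^ (-t) - a ^ (-t) - b ^ (-t) - c ^ (-t) + 1 = 0) : False := by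
  have ha : 0 < a := by linarith
  have hb : 0 < b := by linarith
  have hc : 0 < c := by linarith
  have ht : 0 < t := by linarith
  have key : ∀ u : ℝ, d₁ ^ (-u) + d₂ ^ (-u) - a ^ (-u) - b ^ (-u) - c ^ (-u) + 1 = 0 →
      (c / d₁) ^ u + (c / d₂) ^ u - (c / a) ^ u - (c / b) ^ u - 1 + c ^ u = 0 := by
    intro u hu
    have q : ∀ v : ℝ, 0 < v → (c / v) ^ u = c ^ u * v ^ (-u) := by
      intro v hv
      rw [Real.div_rpow hc.le hv.le, Real.rpow_neg hv.le, div_eq_mul_inv]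
    have q1 : c ^ u * c ^ (-u) = 1 := by rw [← Real.rpow_add hc]; simp
    rw [q _ h3, q _ h6, q _ ha, q _ hb]
    linear_combination c ^ u * hu + q1
  have ks := key s es
  have kt := key t et
  have pw : ∀ v : ℝ, 0 < v → v ^ s = (v ^ t) ^ (s / t) := by
    intro v hv
    rw [← Real.rpow_mul hv.le, mul_div_cancel₀ _ ht.ne']
  have l0 : 0 < s / t := by positivity
  have l1 : s / t < 1 := by rwa [div_lt_one ht]
  have A := (diff_aux ((c / d₁) ^ t) ((c / a) ^ t) (s / t)
    (Real.one_le_rpow (by rwa [one_le_div ha]) ht.le)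
    (Real.rpow_le_rpow (by positivity) (by gcongr) ht.le) l0 l1).1
  have hlt : (c / b) ^ t < (c / d₂) ^ t :=
    Real.rpow_lt_rpow (by positivity) (by gcongr) ht
  have B := (diff_aux ((c / d₂) ^ t) ((c / b) ^ t) (s / t)
    (Real.one_le_rpow (by rwa [one_le_div hb]) ht.le) hlt.le l0 l1).2 hlt
  have C := bern_aux (c ^ t) (s / t) (by positivity) l0 l1
  rw [← pw _ (by positivity), ← pw _ (by positivity)] at A B
  rw [← pw _ hc] at C
  have : s / t * ((c / d₁) ^ t + (c / d₂) ^ t - (c / a) ^ t - (c / b) ^ t - 1 + c ^ t) = 0 := by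
    rw [kt, mul_zero]
  linarith


/-- Lemma 3 of the paper: with `c ≥ a ≥ d₁ > 0` and `c ≥ b > d₂ > 0`, the equation
`d₁^(−β) + d₂^(−β) − a^(−β) − b^(−β) − c^(−β) + 1 = 0` has at most one solution `β > 0`. -/
theorem stmt0 (a b c d₁ d₂ : ℝ)
    (h1 : c ≥ a) (h2 : a ≥ d₁) (h3 : d₁ > 0)
    (h4 : c ≥ b) (h5 : b > d₂) (h6 : d₂ > 0) :
    ∀ β₁ β₂ : ℝ, β₁ > 0 → β₂ > 0 →
      d₁ ^ (-β₁) + d₂ ^ (-β₁) - a ^ (-β₁) - b ^ (-β₁) - c ^ (-β₁) + 1 = 0 →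
      d₁ ^ (-β₂) + d₂ ^ (-β₂) - a ^ (-β₂) - b ^ (-β₂) - c ^ (-β₂) + 1 = 0 →
      β₁ = β₂ := by
  intro s t hs ht es et
  rcases lt_trichotomy s t with h | h | h
  · exact (no_two a b c d₁ d₂ h1 h2 h3 h4 h5 h6 s t hs h es et).elim
  · exact h
  · exact (no_two a b c d₁ d₂ h1 h2 h3 h4 h5 h6 t s ht h et es).elim
end

section
/- For real numbers r and s with r > s ≥ 1, the function β ↦ r^β − s^β is strictly convex on the interval [0, ∞). -/
/-- For `r > s ≥ 1`, the function `β ↦ r^β − s^β` is strictly convex on `[0, ∞)`. -/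
theorem stmt1 (r s : ℝ) (hrs : r > s) (hs : s ≥ 1) :
    StrictConvexOn ℝ (Set.Ici (0 : ℝ)) (fun β : ℝ => r ^ β - s ^ β) := by
  have hs0 : 0 < s := by linarith
  have hr0 : 0 < r := by linarith
  have key : ∀ a : ℝ, 0 < a → ∀ x : ℝ,
      HasDerivAt (fun β : ℝ => a ^ β) (Real.log a * a ^ x) x := by
    intro a ha x
    have h := (hasDerivAt_id x).const_rpow ha
    simpa using h
  have h1 : deriv (fun β : ℝ => r ^ β - s ^ β)
      = fun β : ℝ => Real.log r * r ^ β - Real.log s * s ^ β := by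
    funext x
    exact ((key r hr0 x).sub (key s hs0 x)).deriv
  have h2 : ∀ x : ℝ, deriv (fun β : ℝ => Real.log r * r ^ β - Real.log s * s ^ β) x
      = Real.log r * (Real.log r * r ^ x) - Real.log s * (Real.log s * s ^ x) := by
    intro x
    exact (((key r hr0 x).const_mul _).sub ((key s hs0 x).const_mul _)).deriv
  apply strictConvexOn_of_deriv2_pos (convex_Ici 0)
  · intro x _
    exact ((key r hr0 x).sub (key s hs0 x)).continuousAt.continuousWithinAt
  · intro x hx
    rw [interior_Ici] at hx
    have hx0 : (0 : ℝ) < x := hx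
    simp only [Function.iterate_succ, Function.iterate_zero, Function.comp_apply, id]
    rw [h1, h2]
    have hls : 0 ≤ Real.log s := Real.log_nonneg hs
    have hl : Real.log s < Real.log r := Real.log_lt_log hs0 hrs
    have hp : s ^ x < r ^ x := Real.rpow_lt_rpow hs0.le hrs hx0
    have hsx : 0 < s ^ x := Real.rpow_pos_of_pos hs0 x
    have h3 : Real.log s * s ^ x < Real.log r * r ^ x := by nlinarith
    have h4 : 0 ≤ Real.log s * s ^ x := by positivity
    nlinarith
end

section
/- Let a, b, c, d₁, d₂ be real numbers with c ≥ a ≥ d₁ > 0 and c ≥ b > d₂ > 0. Then the function β ↦ (c/d₁)^β − (c/a)^β + (c/d₂)^β − (c/b)^β + c^β − 1 is strictly convex on [0, ∞). -/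
lemma aux_d (p k : ℝ) (hp : 0 < p) (x : ℝ) :
    HasDerivAt (fun y : ℝ => k * p ^ y) (k * Real.log p * p ^ x) x := by
  have h := ((Real.hasStrictDerivAt_const_rpow hp x).hasDerivAt).const_mul k
  have e : k * Real.log p * p ^ x = k * (p ^ x * Real.log p) := by ring
  rw [e]
  exact h

lemma aux_le (p q x : ℝ) (hq : 1 ≤ q) (hpq : q ≤ p) (hx : 0 ≤ x) :
    Real.log q * Real.log q * q ^ x ≤ Real.log p * Real.log p * p ^ x := by
  have h0 := Real.log_nonneg hq
  have h1 := Real.log_le_log (by linarith) hpq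
  have h2 : q ^ x ≤ p ^ x := Real.rpow_le_rpow (by linarith) hpq hx
  have h3 : 0 ≤ q ^ x := Real.rpow_nonneg (by linarith) x
  have h4 := mul_le_mul h1 h1 h0 (h0.trans h1)
  exact mul_le_mul h4 h2 h3 (mul_self_nonneg _)

lemma aux_lt (p q x : ℝ) (hq : 1 ≤ q) (hpq : q < p) (hx : 0 ≤ x) :
    Real.log q * Real.log q * q ^ x < Real.log p * Real.log p * p ^ x := by
  have h0 := Real.log_nonneg hq
  have h1 := Real.log_lt_log (by linarith) hpq
  have h2 : q ^ x ≤ p ^ x := Real.rpow_le_rpow (by linarith) hpq.le hx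
  have h3 : 0 < q ^ x := Real.rpow_pos_of_pos (by linarith) x
  have h4 := mul_lt_mul'' h1 h1 h0 h0
  exact mul_lt_mul h4 h2 h3 (mul_self_nonneg _)

/-- With `c ≥ a ≥ d₁ > 0` and `c ≥ b > d₂ > 0`, the function
`β ↦ (c/d₁)^β − (c/a)^β + (c/d₂)^β − (c/b)^β + c^β − 1` is strictly convex on `[0, ∞)`. -/
theorem stmt2 (a b c d₁ d₂ : ℝ)
    (h1 : c ≥ a) (h2 : a ≥ d₁) (h3 : d₁ > 0)
    (h4 : c ≥ b) (h5 : b > d₂) (h6 : d₂ > 0) :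
    StrictConvexOn ℝ (Set.Ici (0 : ℝ))
      (fun β : ℝ => (c / d₁) ^ β - (c / a) ^ β + ((c / d₂) ^ β - (c / b) ^ β) + (c ^ β - 1)) := by
  have ha : 0 < a := by linarith
  have hb : 0 < b := by linarith
  have hc : 0 < c := by linarith
  have q1 : 1 ≤ c / a := (one_le_div ha).2 h1
  have q2 : 1 ≤ c / b := (one_le_div hb).2 h4
  have p1 : c / a ≤ c / d₁ := div_le_div_of_nonneg_left hc.le h3 h2
  have p2 : c / b < c / d₂ := div_lt_div_of_pos_left hc h6 h5
  generalize c / a = q at *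
  generalize c / b = r at *
  generalize c / d₁ = p at *
  generalize c / d₂ = s at *
  have hq : 0 < q := by linarith
  have hr : 0 < r := by linarith
  have hp : 0 < p := by linarith
  have hs : 0 < s := by linarith
  have D (k1 k2 k3 k4 k5 k6 x : ℝ) := ((((aux_d p k1 hp x).sub (aux_d q k2 hq x)).add
    ((aux_d s k3 hs x).sub (aux_d r k4 hr x))).add ((aux_d c k5 hc x).sub_const k6))
  have E1 : ∀ x, HasDerivAt (fun β : ℝ => p ^ β - q ^ β + (s ^ β - r ^ β) + (c ^ β - 1))
      (Real.log p * p ^ x - Real.log q * q ^ x + (Real.log s * s ^ x - Real.log r * r ^ x)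
        + (Real.log c * c ^ x - 0)) x := by
    intro x
    have := D 1 1 1 1 1 1 x
    simp only [one_mul] at this
    rw [sub_zero]
    exact this
  apply strictConvexOn_of_deriv2_pos (convex_Ici 0)
  · exact fun x _ => (E1 x).continuousAt.continuousWithinAt
  · intro x hx
    rw [interior_Ici] at hx
    have hx0 : 0 ≤ x := le_of_lt hx
    have e : deriv (fun β : ℝ => p ^ β - q ^ β + (s ^ β - r ^ β) + (c ^ β - 1)) = _ :=
      funext fun x => (E1 x).deriv
    simp only [Function.iterate_succ, Function.iterate_zero, Function.comp, id]
    rw [e]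
    have E2 := (D (Real.log p) (Real.log q) (Real.log s) (Real.log r) (Real.log c) 0 x).deriv
    refine lt_of_lt_of_eq ?_ E2.symm
    have i1 := aux_le p q x q1 p1 hx0
    have i2 := aux_lt s r x q2 p2 hx0
    have i3 : 0 ≤ Real.log c * Real.log c * c ^ x :=
      mul_nonneg (mul_self_nonneg _) (Real.rpow_nonneg hc.le x)
    linarith
end

section
/- Let κ ≥ 3, let π ∈ ℝ^κ have all entries positive, and let U be a real κ×κ matrix whose first column is the all-ones vector and which satisfies Uᵀ·diag(π)·U = I. Then there exist indices i, j, k, each at least 2 (not necessarily distinct), such that ν_{ijk} = Σ_l π_l U_{li} U_{lj} U_{lk} is nonzero. -/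
open Matrix in
/-- Proposition 2 of the paper: for `κ ≥ 3`, positive `π`, and `U` with first column the
all-ones vector and columns orthonormal w.r.t. `⟨x,y⟩ = Σ_l π_l x_l y_l`, some
`ν_{ijk} = Σ_l π_l U_{li} U_{lj} U_{lk}` with `i, j, k ≥ 2` (i.e. not the first index)
is nonzero. -/
theorem stmt4 (κ : ℕ) (hκ : 3 ≤ κ) (π : Fin κ → ℝ) (hπ : ∀ l, 0 < π l)
    (U : Matrix (Fin κ) (Fin κ) ℝ) (hκ0 : 0 < κ)
    (hU1 : ∀ l, U l ⟨0, hκ0⟩ = 1)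
    (horth : Uᵀ * Matrix.diagonal π * U = 1) :
    ∃ i j k : Fin κ, i ≠ ⟨0, hκ0⟩ ∧ j ≠ ⟨0, hκ0⟩ ∧ k ≠ ⟨0, hκ0⟩ ∧
      ∑ l, π l * U l i * U l j * U l k ≠ 0 := by
  by_contra hcon
  push Not at hcon
  have hcomm : U * (Uᵀ * Matrix.diagonal π) = 1 := mul_eq_one_comm.mp horth
  have horth' : ∀ i j, ∑ m, U m i * π m * U m j = (1 : Matrix (Fin κ) (Fin κ) ℝ) i j := by
    intro i j
    rw [← horth, Matrix.mul_apply]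
    simp [Matrix.mul_diagonal]
  have hcomm' : ∀ l m, ∑ k, U l k * (U m k * π m) = (1 : Matrix (Fin κ) (Fin κ) ℝ) l m := by
    intro l m
    rw [← hcomm, Matrix.mul_apply]
    simp [Matrix.mul_diagonal]
  have key : ∀ i j, i ≠ ⟨0, hκ0⟩ → j ≠ ⟨0, hκ0⟩ → ∀ l,
      U l i * U l j = (1 : Matrix (Fin κ) (Fin κ) ℝ) i j := by
    intro i j hi hj l
    have h1 : U l i * U l j
        = ∑ m, (∑ k, U l k * (U m k * π m)) * (U m i * U m j) := by
      simp [hcomm', Matrix.one_apply]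
    have h2 : ∑ m, (∑ k, U l k * (U m k * π m)) * (U m i * U m j)
        = ∑ k, U l k * ∑ m, π m * U m i * U m j * U m k := by
      simp_rw [Finset.sum_mul, Finset.mul_sum]
      rw [Finset.sum_comm]
      refine Finset.sum_congr rfl fun k _ => Finset.sum_congr rfl fun m _ => by ring
    rw [h1, h2, Finset.sum_eq_single (⟨0, hκ0⟩ : Fin κ)]
    · rw [← horth' i j, hU1, one_mul]
      refine Finset.sum_congr rfl fun m _ => ?_
      rw [hU1]; ring
    · intro k _ hk
      rw [hcon i j k hi hj hk, mul_zero]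
    · simp
  have n1 : (⟨1, by omega⟩ : Fin κ) ≠ ⟨0, hκ0⟩ := by simp
  have n2 : (⟨2, by omega⟩ : Fin κ) ≠ ⟨0, hκ0⟩ := by simp
  have a := key _ _ n1 n1 ⟨0, hκ0⟩
  have b := key _ _ n2 n2 ⟨0, hκ0⟩
  have c := key _ _ n1 n2 ⟨0, hκ0⟩
  rw [Matrix.one_apply_eq] at a b
  rw [Matrix.one_apply_ne (by simp)] at c
  rcases mul_eq_zero.mp c with h | h
  · rw [h] at a; simp at a
  · rw [h] at b; simp at b
end

section
/- Let π ∈ ℝ⁴ have all entries positive, and let U be a real 4×4 matrix whose first column is the all-ones vector and which satisfies Uᵀ·diag(π)·U = I. Suppose Σ_l π_l U_{li} U_{l4}² = 0 for each i ∈ {2, 3, 4}. Then every entry of the fourth column of U equals 1 or −1. -/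
open Matrix in
/-- If `Σ_l π_l U_{li} U_{l4}² = 0` for each `i ∈ {2,3,4}` (last three columns), then every
entry of the fourth column of `U` is `±1`. -/
theorem stmt6 (π : Fin 4 → ℝ) (hπ : ∀ l, 0 < π l)
    (U : Matrix (Fin 4) (Fin 4) ℝ)
    (hU1 : ∀ l, U l 0 = 1)
    (horth : Uᵀ * Matrix.diagonal π * U = 1)
    (hν : ∀ i : Fin 4, i ≠ 0 → ∑ l, π l * U l i * (U l 3) ^ 2 = 0) :
    ∀ l, U l 3 = 1 ∨ U l 3 = -1 := by
  have h2 : U * (Uᵀ * Matrix.diagonal π) = 1 := mul_eq_one_comm.mp horth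
  have h3 : (Uᵀ * Matrix.diagonal π) *ᵥ (fun l => (U l 3) ^ 2) = Pi.single 0 1 := by
    funext i
    have e : ((Uᵀ * Matrix.diagonal π) *ᵥ (fun l => (U l 3) ^ 2)) i
        = ∑ l, π l * U l i * (U l 3) ^ 2 := by
      simp only [Matrix.mulVec, dotProduct, Matrix.mul_diagonal, Matrix.transpose_apply]
      exact Finset.sum_congr rfl fun l _ => by ring
    rw [e]
    by_cases hi : i = 0
    · subst hi
      have h := congrFun (congrFun horth 3) 3
      rw [Matrix.mul_apply, Matrix.one_apply_eq] at h
      rw [Pi.single_eq_same, ← h]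
      refine Finset.sum_congr rfl fun l _ => ?_
      rw [Matrix.mul_diagonal, Matrix.transpose_apply, hU1]
      ring
    · rw [hν i hi, Pi.single_eq_of_ne hi]
  intro l
  have h4 := congrArg (fun v => (U *ᵥ v) l) h3
  simp only [Matrix.mulVec_mulVec, h2, Matrix.one_mulVec, Matrix.mulVec_single_one,
    Matrix.col_apply, hU1] at h4
  simpa using h4
end

section
/- Let b, c ≥ 0 with b² + c² = 2, let U be the real 4×4 matrix with rows (1, c, b, 1), (1, −c, −b, 1), (1, −b, c, −1), (1, b, −c, −1), and let λ₂, λ₃, λ₄ be reals with 0 > λ₂ ≥ λ₃ ≥ λ₄. Define the symmetric matrix Q̃ = U·diag(0, λ₂, λ₃, λ₄)·Uᵀ. If every off-diagonal entry of Q̃ is positive, then λ₄ > λ₂ + λ₃; moreover, if b·c = 0 then λ₄ > 2·λ₂. -/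
open Matrix in
/-- Lemma 5, Case A: eigenvalue inequalities forced by positivity of the off-diagonal
entries of `Q̃ = U·diag(0,l₂,l₃,l₄)·Uᵀ` for the Case A eigenvector matrix `U`. -/
theorem stmt8 (b c : ℝ) (hb : 0 ≤ b) (hc : 0 ≤ c) (hbc : b ^ 2 + c ^ 2 = 2)
    (l₂ l₃ l₄ : ℝ) (h2 : l₂ < 0) (h23 : l₃ ≤ l₂) (h34 : l₄ ≤ l₃)
    (U : Matrix (Fin 4) (Fin 4) ℝ)
    (hU : U = !![1, c, b, 1; 1, -c, -b, 1; 1, -b, c, -1; 1, b, -c, -1])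
    (Q : Matrix (Fin 4) (Fin 4) ℝ)
    (hQ : Q = U * Matrix.diagonal ![0, l₂, l₃, l₄] * Uᵀ)
    (hpos : ∀ i j : Fin 4, i ≠ j → 0 < Q i j) :
    l₄ > l₂ + l₃ ∧ (b * c = 0 → l₄ > 2 * l₂) := by
  have h1 := hpos 0 1 (by decide)
  have h3 := hpos 2 3 (by decide)
  subst hQ hU
  simp [Matrix.mul_apply, Fin.sum_univ_four, Matrix.vecMul_diagonal] at h1 h3
  have e1 : 0 < -(c ^ 2 * l₂) - b ^ 2 * l₃ + l₄ := by linarith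
  have e3 : 0 < -(b ^ 2 * l₂) - c ^ 2 * l₃ + l₄ := by linarith
  have hc2 : c ^ 2 = 2 - b ^ 2 := by linarith
  rw [hc2] at e1 e3
  refine ⟨by linarith, fun h => ?_⟩
  rcases mul_eq_zero.mp h with h | h
  · subst h
    linarith
  · subst h
    have hb2 : b ^ 2 = 2 := by linarith
    rw [hb2] at e3
    linarith
end

section
/- Let U be the real 4×4 matrix with rows (1, 2, √2, 1), (1, −2, √2, 1), (1, 0, −√2, 1), (1, 0, 0, −1), and let λ₂, λ₃, λ₄ be reals with 0 > λ₂ ≥ λ₃ ≥ λ₄. Define the symmetric matrix Q̃ = U·diag(0, λ₂, λ₃, λ₄)·Uᵀ. If every off-diagonal entry of Q̃ is positive, then λ₄ > 2·λ₂. -/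
open Matrix in
/-- Lemma 5, Case B: eigenvalue inequality forced by positivity of the off-diagonal
entries of `Q̃ = U·diag(0,l₂,l₃,l₄)·Uᵀ` for the Case B eigenvector matrix `U`. -/
theorem stmt9 (l₂ l₃ l₄ : ℝ) (h2 : l₂ < 0) (h23 : l₃ ≤ l₂) (h34 : l₄ ≤ l₃)
    (U : Matrix (Fin 4) (Fin 4) ℝ)
    (hU : U = !![1, 2, Real.sqrt 2, 1; 1, -2, Real.sqrt 2, 1;
                 1, 0, -Real.sqrt 2, 1; 1, 0, 0, -1])
    (Q : Matrix (Fin 4) (Fin 4) ℝ)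
    (hQ : Q = U * Matrix.diagonal ![0, l₂, l₃, l₄] * Uᵀ)
    (hpos : ∀ i j : Fin 4, i ≠ j → 0 < Q i j) :
    l₄ > 2 * l₂ := by
  have hs : Real.sqrt 2 * Real.sqrt 2 = 2 := Real.mul_self_sqrt (by norm_num)
  have h01 := hpos 0 1 (by decide)
  have h02 := hpos 0 2 (by decide)
  subst hQ
  subst hU
  simp only [Matrix.mul_apply, Matrix.mul_diagonal, Fin.sum_univ_four, Matrix.transpose_apply] at h01 h02
  simp at h01 h02
  have e : Real.sqrt 2 * l₃ * Real.sqrt 2 = 2 * l₃ := by linear_combination l₃ * hs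
  linarith
end

section
/- Let π ∈ ℝ² have both entries positive, and let U be a real 2×2 matrix whose first column is the all-ones vector and which satisfies Uᵀ·diag(π)·U = I. If Σ_l π_l U_{l2}³ = 0, then π = (1/2, 1/2) and the second column of U is either (1, −1) or (−1, 1). -/
open Matrix in
/-- The 2-state case: if `Σ_l π_l U_{l2}³ = 0` then `π = (1/2, 1/2)` and the second column
of `U` is `(1, −1)` or `(−1, 1)`. -/
theorem stmt10 (π : Fin 2 → ℝ) (hπ : ∀ l, 0 < π l)
    (U : Matrix (Fin 2) (Fin 2) ℝ)
    (hU1 : ∀ l, U l 0 = 1)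
    (horth : Uᵀ * Matrix.diagonal π * U = 1)
    (hν : ∑ l, π l * (U l 1) ^ 3 = 0) :
    π = ![1/2, 1/2] ∧ ((U 0 1 = 1 ∧ U 1 1 = -1) ∨ (U 0 1 = -1 ∧ U 1 1 = 1)) := by
  have h00 := congrFun (congrFun horth 0) 0
  have h01 := congrFun (congrFun horth 0) 1
  have h11 := congrFun (congrFun horth 1) 1
  simp [Matrix.mul_apply, Fin.sum_univ_two, Matrix.diagonal, hU1] at h00 h01 h11
  rw [Fin.sum_univ_two] at hν
  generalize U 0 1 = a at *
  generalize U 1 1 = b at *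
  have h1 : π 0 * a * (a - b) = 1 := by linear_combination h11 - b * h01
  have hb : b = -a := by
    linear_combination (-(a + b)) * h1 + hν - b ^ 2 * h01
  subst hb
  have ha : a ≠ 0 := by
    rintro rfl
    simp at h1
  have hpq : π 0 = π 1 := by
    have : a * (π 0 - π 1) = 0 := by linear_combination h01
    rcases mul_eq_zero.mp this with h | h
    · exact absurd h ha
    · linarith
  have hp : π 0 = 1 / 2 := by linarith
  have hq : π 1 = 1 / 2 := by linarith
  refine ⟨?_, ?_⟩
  · ext l
    fin_cases l <;> simp [hp, hq]
  · rw [hp] at h1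
    have h2 : (a - 1) * (a + 1) = 0 := by linear_combination h1
    rcases mul_eq_zero.mp h2 with h | h
    · left
      constructor <;> linarith
    · right
      constructor <;> linarith
end

section
/- Define f : ℝ → ℝ by f(x) = ∫₀^x exp(exp(−10·(t−1)²) − (1−t)²/10) dt. Then f is strictly increasing on ℝ, and f is bounded above on [0, ∞); consequently f(x) tends to a finite limit as x → ∞ (f has a horizontal asymptote). -/
open intervalIntegral in
/-- The counterexample function `f(x) = ∫₀ˣ exp(exp(−10(t−1)²) − (1−t)²/10) dt` is strictly
increasing on `ℝ`, bounded above on `[0, ∞)`, and tends to a finite limit as `x → ∞`. -/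
theorem stmt14 :
    StrictMono (fun x : ℝ =>
      ∫ t in (0 : ℝ)..x, Real.exp (Real.exp (-10 * (t - 1) ^ 2) - (1 - t) ^ 2 / 10)) ∧
    BddAbove ((fun x : ℝ =>
      ∫ t in (0 : ℝ)..x, Real.exp (Real.exp (-10 * (t - 1) ^ 2) - (1 - t) ^ 2 / 10)) ''
        Set.Ici (0 : ℝ)) ∧
    ∃ L : ℝ, Filter.Tendsto (fun x : ℝ =>
      ∫ t in (0 : ℝ)..x, Real.exp (Real.exp (-10 * (t - 1) ^ 2) - (1 - t) ^ 2 / 10))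
      Filter.atTop (nhds L) := by
  have hc : Continuous (fun t : ℝ =>
      Real.exp (Real.exp (-10 * (t - 1) ^ 2) - (1 - t) ^ 2 / 10)) := by fun_prop
  have hint : MeasureTheory.Integrable (fun t : ℝ =>
      Real.exp (Real.exp (-10 * (t - 1) ^ 2) - (1 - t) ^ 2 / 10)) := by
    have h1 := ((integrable_exp_neg_mul_sq (b := 1 / 10) (by norm_num)).comp_sub_right
      (1 : ℝ)).const_mul (Real.exp 1)
    refine h1.mono' hc.aestronglyMeasurable (Filter.Eventually.of_forall fun t => ?_)
    rw [Real.norm_of_nonneg (Real.exp_pos _).le, ← Real.exp_add]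
    apply Real.exp_le_exp.mpr
    have h2 : Real.exp (-10 * (t - 1) ^ 2) ≤ 1 :=
      Real.exp_le_one_iff.mpr (by nlinarith [sq_nonneg (t - 1)])
    nlinarith
  have hmono : StrictMono (fun x : ℝ =>
      ∫ t in (0 : ℝ)..x, Real.exp (Real.exp (-10 * (t - 1) ^ 2) - (1 - t) ^ 2 / 10)) := by
    intro a b hab
    have h3 := intervalIntegral.integral_interval_sub_left
      (hc.intervalIntegrable (μ := MeasureTheory.volume) 0 b) (hc.intervalIntegrable 0 a)
    have h4 := intervalIntegral.intervalIntegral_pos_of_pos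
      (hc.intervalIntegrable a b) (fun t => Real.exp_pos _) hab
    simp only
    linarith
  have hlim := MeasureTheory.intervalIntegral_tendsto_integral_Ioi (0 : ℝ)
    hint.integrableOn Filter.tendsto_id
  refine ⟨hmono, ⟨∫ t in Set.Ioi (0 : ℝ),
    Real.exp (Real.exp (-10 * (t - 1) ^ 2) - (1 - t) ^ 2 / 10), ?_⟩, _, hlim⟩
  rintro _ ⟨x, _, rfl⟩
  exact hmono.monotone.ge_of_tendsto hlim x
end

section
/- Define f : ℝ → ℝ by f(x) = ∫₀^x exp(exp(−10·(t−1)²) − (1−t)²/10) dt. Then f is strictly convex on the interval (−∞, 1] and strictly concave on the interval [1, ∞); in particular f has a single inflection point, at x = 1, where its graph changes from convex to concave. -/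
/-- The counterexample function `f(x) = ∫₀ˣ exp(exp(−10(t−1)²) − (1−t)²/10) dt` is strictly
convex on `(−∞, 1]` and strictly concave on `[1, ∞)`. -/
theorem stmt15 :
    StrictConvexOn ℝ (Set.Iic (1 : ℝ)) (fun x : ℝ =>
      ∫ t in (0 : ℝ)..x, Real.exp (Real.exp (-10 * (t - 1) ^ 2) - (1 - t) ^ 2 / 10)) ∧
    StrictConcaveOn ℝ (Set.Ici (1 : ℝ)) (fun x : ℝ =>
      ∫ t in (0 : ℝ)..x, Real.exp (Real.exp (-10 * (t - 1) ^ 2) - (1 - t) ^ 2 / 10)) := by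
  have hc : Continuous (fun t : ℝ =>
      Real.exp (Real.exp (-10 * (t - 1) ^ 2) - (1 - t) ^ 2 / 10)) := by fun_prop
  have hd : ∀ x : ℝ, HasDerivAt (fun x : ℝ =>
      ∫ t in (0 : ℝ)..x, Real.exp (Real.exp (-10 * (t - 1) ^ 2) - (1 - t) ^ 2 / 10))
      (Real.exp (Real.exp (-10 * (x - 1) ^ 2) - (1 - x) ^ 2 / 10)) x := fun x =>
    intervalIntegral.integral_hasDerivAt_right (hc.intervalIntegrable _ _)
      (hc.stronglyMeasurableAtFilter _ _) hc.continuousAt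
  have key : ∀ x y : ℝ, (x - 1) ^ 2 < (y - 1) ^ 2 →
      Real.exp (Real.exp (-10 * (y - 1) ^ 2) - (1 - y) ^ 2 / 10) <
      Real.exp (Real.exp (-10 * (x - 1) ^ 2) - (1 - x) ^ 2 / 10) := by
    intro x y h
    have h1 : Real.exp (-10 * (y - 1) ^ 2) < Real.exp (-10 * (x - 1) ^ 2) :=
      Real.exp_lt_exp.mpr (by linarith)
    apply Real.exp_lt_exp.mpr
    nlinarith
  have hcont := fun s : Set ℝ => (continuous_iff_continuousAt.mpr
    fun x => (hd x).continuousAt).continuousOn (s := s)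
  constructor
  · refine StrictMonoOn.strictConvexOn_of_deriv (convex_Iic 1) (hcont _) ?_
    rw [interior_Iic]
    intro x hx y hy hxy
    rw [(hd x).deriv, (hd y).deriv]
    simp only [Set.mem_Iio] at hx hy
    exact key _ _ (by nlinarith)
  · refine StrictAntiOn.strictConcaveOn_of_deriv (convex_Ici 1) (hcont _) ?_
    rw [interior_Ici]
    intro x hx y hy hxy
    rw [(hd x).deriv, (hd y).deriv]
    simp only [Set.mem_Ioi] at hx hy
    exact key _ _ (by nlinarith)
end
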